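/- Let Σ ⊂ ℝ^d be compact with Euclidean diameter diam(Σ), let d be a lower semicontinuous transport cost with d(ξ,ξ) = 0 and values in [0, diam(Σ)], and let ℓ(x,ξ) be nonnegative and upper semicontinuous in ξ for every x ∈ X. For ε ∈ (0, diam(Σ)] and K ≥ 1, let Δ_K = { ε·k/K : k = 0,…,K } ∪ { ε·(diam(Σ)/ε)^{k/K} : k = 0,…,K } and define the discretized predictor ĉ^K_{d,ε}(x,P̂) = min_{γ≥0} ( ∫ max_{δ∈Δ_K} (ℓ^δ(x,ξ) − γδ) dP̂(ξ) + εγ ). Then ĉ^K_{d,ε}(x,P̂) ≤ ĉ_{d,ε}(x,P̂) ≤ ((diam(Σ)/ε)^{1/K} + 1/K) · ĉ^K_{d,ε}(x,P̂) for all x ∈ X and P̂ ∈ P(Σ). -/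

import Mathlib

open MeasureTheory Set Filter Metric Topology
open scoped ENNReal NNReal

set_option linter.unusedSectionVars false

noncomputable section

namespace Dro

variable {Ω : Type*} [MeasurableSpace Ω] [NormedAddCommGroup Ω] [BorelSpace Ω]
variable {X : Type*}

/-- The set of Borel probability measures supported on `S`. -/
def PMOn (S : Set Ω) : Set (ProbabilityMeasure Ω) := {μ | (μ : Measure Ω) S = 1}

/-- The expected loss `c(x, P) = E_P[ℓ(x, ξ)]`. -/
def cost (ℓ : X → Ω → ℝ) (x : X) (P : ProbabilityMeasure Ω) : ℝ :=
  ∫ ξ, ℓ x ξ ∂(P : Measure Ω)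

open Classical in
/-- Kullback–Leibler divergence `D_KL(μ, ν) = ∫ log (dμ/dν) dμ` if `μ ≪ ν`, `∞` otherwise. -/
def klDiv (μ ν : Measure Ω) : ℝ≥0∞ :=
  if μ ≪ ν ∧ Integrable (fun ξ => Real.log ((μ.rnDeriv ν ξ).toReal)) μ
  then ENNReal.ofReal (∫ ξ, Real.log ((μ.rnDeriv ν ξ).toReal) ∂μ)
  else ⊤

/-- 1-Wasserstein distance: infimum of `∫ ‖ξ' - ξ‖ dγ` over couplings `γ`. -/
def wdist (μ ν : Measure Ω) : ℝ≥0∞ :=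
  ⨅ (γ : Measure (Ω × Ω)) (_ : γ.map Prod.fst = μ) (_ : γ.map Prod.snd = ν),
    ∫⁻ p, edist p.1 p.2 ∂γ

/-- Lévy–Prokhorov distance. -/
def lpDist (μ ν : Measure Ω) : ℝ :=
  sInf {ε : ℝ | 0 < ε ∧ ∀ A : Set Ω, MeasurableSet A →
      (μ A ≤ ν (Metric.cthickening ε A) + ENNReal.ofReal ε ∧
       ν A ≤ μ (Metric.cthickening ε A) + ENNReal.ofReal ε)}

/-- Wasserstein-smoothed KL divergence `D^ε_{KL,W}(P', P)`. -/
def klSmoothW (S : Set Ω) (ε : ℝ) (P' P : ProbabilityMeasure Ω) : ℝ≥0∞ :=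
  ⨅ (Q : ProbabilityMeasure Ω) (_ : Q ∈ PMOn S ∧
      wdist (P' : Measure Ω) (Q : Measure Ω) ≤ ENNReal.ofReal ε),
    klDiv (Q : Measure Ω) (P : Measure Ω)

/-- Lévy-Prokhorov-smoothed KL divergence `D^ε_{KL,LP}(P', P)`. -/
def klSmoothLP (S : Set Ω) (ε : ℝ) (P' P : ProbabilityMeasure Ω) : ℝ≥0∞ :=
  ⨅ (Q : ProbabilityMeasure Ω) (_ : Q ∈ PMOn S ∧
      lpDist (P' : Measure Ω) (Q : Measure Ω) ≤ ε),
    klDiv (Q : Measure Ω) (P : Measure Ω)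

/-- The KL-DRO predictor `ĉ_{KL,r}`. -/
def cKL (S : Set Ω) (ℓ : X → Ω → ℝ) (r : ℝ) (x : X) (Phat : ProbabilityMeasure Ω) : ℝ :=
  sSup {v | ∃ P ∈ PMOn S,
    klDiv (Phat : Measure Ω) (P : Measure Ω) ≤ ENNReal.ofReal r ∧ v = cost ℓ x P}

/-- The Wasserstein-smoothed KL-DRO predictor `ĉ^ε_{KL,W,r}`. -/
def cKLW (S : Set Ω) (ℓ : X → Ω → ℝ) (ε r : ℝ) (x : X) (Phat : ProbabilityMeasure Ω) : ℝ :=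
  sSup {v | ∃ P ∈ PMOn S, klSmoothW S ε Phat P ≤ ENNReal.ofReal r ∧ v = cost ℓ x P}

/-- The LP-smoothed KL-DRO predictor `ĉ^ε_{KL,LP,r}`. -/
def cKLLP (S : Set Ω) (ℓ : X → Ω → ℝ) (ε r : ℝ) (x : X) (Phat : ProbabilityMeasure Ω) : ℝ :=
  sSup {v | ∃ P ∈ PMOn S, klSmoothLP S ε Phat P ≤ ENNReal.ofReal r ∧ v = cost ℓ x P}

/-- The empirical measure of samples `ω 0, …, ω (N-1)`. -/
def empMeas {N : ℕ} (ω : Fin N → Ω) : Measure Ω :=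
  (N : ℝ≥0∞)⁻¹ • ∑ i, Measure.dirac (ω i)

theorem empMeas_isProbability {N : ℕ} (hN : N ≠ 0) (ω : Fin N → Ω) :
    IsProbabilityMeasure (empMeas ω) := by
  constructor
  have h1 : (∑ i : Fin N, Measure.dirac (ω i)) (Set.univ : Set Ω) = N := by
    rw [Measure.finset_sum_apply]
    simp
  rw [empMeas, Measure.smul_apply, h1, smul_eq_mul, ENNReal.inv_mul_cancel]
  · exact_mod_cast hN
  · exact ENNReal.natCast_ne_top N

open Classical in
/-- The empirical distribution `P_N` as a probability measure (junk value for `N = 0`). -/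
def empPM (N : ℕ) (ω : Fin N → Ω) : ProbabilityMeasure Ω :=
  if h : N = 0 then ⟨Measure.dirac 0, by infer_instance⟩
  else ⟨empMeas ω, empMeas_isProbability h ω⟩

/-- The distribution of `N` i.i.d. samples from `P`. -/
def prodMeas (P : ProbabilityMeasure Ω) (N : ℕ) : Measure (Fin N → Ω) :=
  Measure.pi fun _ => (P : Measure Ω)

/-- The large-deviations rate `limsup_N (1/N) log Pr(E_N)` of a sequence of events. -/
def rate (P : ProbabilityMeasure Ω) (E : (N : ℕ) → Set (Fin N → Ω)) : EReal :=
  Filter.limsup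
    (fun N : ℕ => (((N : ℝ)⁻¹ : ℝ) : EReal) * ENNReal.log (prodMeas P N (E N))) Filter.atTop

/-- A predictor `ĉ` is uniformly feasible at rate `r`. -/
def UnifFeasible (S : Set Ω) (ℓ : X → Ω → ℝ) (chat : X → ProbabilityMeasure Ω → ℝ)
    (r : ℝ) : Prop :=
  ∀ P ∈ PMOn S,
    rate P (fun N => {ω | ∃ x, cost ℓ x P > chat x (empPM N ω)}) ≤ ((-r : ℝ) : EReal)

/-- A predictor `ĉ` is pointwise feasible at rate `r`. -/
def PtFeasible (S : Set Ω) (ℓ : X → Ω → ℝ) (chat : X → ProbabilityMeasure Ω → ℝ)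
    (r : ℝ) : Prop :=
  ∀ P ∈ PMOn S, ∀ x : X,
    rate P (fun N => {ω | cost ℓ x P > chat x (empPM N ω)}) ≤ ((-r : ℝ) : EReal)

end Dro
namespace Dro

variable {Ω : Type*} [MeasurableSpace Ω] [NormedAddCommGroup Ω] [BorelSpace Ω]
variable {X : Type*}

/-- Optimal transport distance `W_d` associated with a transport cost `c`. -/
def wCost (c : Ω → Ω → ℝ) (μ ν : Measure Ω) : ℝ≥0∞ :=
  ⨅ (γ : Measure (Ω × Ω)) (_ : γ.map Prod.fst = μ) (_ : γ.map Prod.snd = ν),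
    ∫⁻ p, ENNReal.ofReal (c p.1 p.2) ∂γ

/-- The `δ`-inflated loss `ℓ^δ(x, ξ) = sup {ℓ(x, ξ') : ξ' ∈ S, d(ξ, ξ') ≤ δ}`. -/
def linfl (S : Set Ω) (c : Ω → Ω → ℝ) (ℓ : X → Ω → ℝ) (δ : ℝ) (x : X) (ξ : Ω) : ℝ :=
  sSup {u | ∃ ξ' ∈ S, c ξ ξ' ≤ δ ∧ u = ℓ x ξ'}

end Dro
namespace Dro

variable {Ω : Type*} [MeasurableSpace Ω] [NormedAddCommGroup Ω] [BorelSpace Ω]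
variable {X : Type*}

/-- The optimal-transport DRO predictor `ĉ_{d,ε}`. -/
def cTrans (S : Set Ω) (c : Ω → Ω → ℝ) (ℓ : X → Ω → ℝ) (ε : ℝ) (x : X)
    (Phat : ProbabilityMeasure Ω) : ℝ :=
  sSup {v | ∃ P ∈ PMOn S,
    wCost c (Phat : Measure Ω) (P : Measure Ω) ≤ ENNReal.ofReal ε ∧ v = cost ℓ x P}

/-- The discretization grid `Δ_K = {ε k/K : k ≤ K} ∪ {ε (dS/ε)^{k/K} : k ≤ K}`. -/
def deltaGrid (dS ε : ℝ) (K : ℕ) : Set ℝ :=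
  ((fun k : Fin (K+1) => ε * k / K) '' Set.univ) ∪
  ((fun k : Fin (K+1) => ε * (dS / ε) ^ (((k : ℕ) : ℝ) / K)) '' Set.univ)

/-- The discretized optimal-transport DRO predictor `ĉ^K_{d,ε}`. -/
def cTransK (S : Set Ω) (c : Ω → Ω → ℝ) (ℓ : X → Ω → ℝ) (ε : ℝ) (K : ℕ) (x : X)
    (Phat : ProbabilityMeasure Ω) : ℝ :=
  sInf {v | ∃ γ : ℝ, 0 ≤ γ ∧
    v = (∫ ξ, sSup {u | ∃ δ ∈ deltaGrid (Metric.diam S) ε K,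
          u = linfl S c ℓ δ x ξ - γ * δ} ∂(Phat : Measure Ω)) + ε * γ}

end Dro

/-- ℝ^d with the Euclidean norm. -/
abbrev Euc (n : ℕ) := EuclideanSpace ℝ (Fin n)

theorem aux_meas_indicator {α : Type*} [MeasurableSpace α] {S : Set α} (hS : MeasurableSet S)
    {f : α → ℝ} (h : ∀ q : ℝ, MeasurableSet {x | x ∈ S ∧ q ≤ f x}) :
    Measurable (S.indicator f) := by
  refine measurable_of_Ici fun q => ?_
  have : S.indicator f ⁻¹' Ici q = {x | x ∈ S ∧ q ≤ f x} ∪ (Sᶜ ∩ {x | q ≤ 0}) := by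
    ext y
    by_cases hy : y ∈ S <;> simp [hy]
  rw [this]
  exact (h q).union (hS.compl.inter (MeasurableSet.const _))

theorem aux_hit_closed {E : Type*} [TopologicalSpace E] [T2Space E] {S : Set E} (hS : IsCompact S)
    {h : E × E → ℝ} (hh : UpperSemicontinuousOn h (S ×ˢ S)) {F : Set E} (hF : IsClosed F) (q : ℝ) :
    IsClosed {ξ | ξ ∈ S ∧ ∃ ξ' ∈ S, ξ' ∈ F ∧ q ≤ h (ξ, ξ')} := by
  have h1 : IsCompact ((S ×ˢ S) ∩ h ⁻¹' (Ici q)) :=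
    hh.isCompact_inter_preimage_Ici (hS.prod hS) q
  have h2 := (h1.inter_right (hF.preimage continuous_snd)).image continuous_fst
  convert h2.isClosed using 1
  ext ξ
  constructor
  · rintro ⟨h1, ξ', h2, h3, h4⟩
    exact ⟨(ξ, ξ'), ⟨⟨⟨h1, h2⟩, h4⟩, h3⟩, rfl⟩
  · rintro ⟨⟨a, b⟩, ⟨⟨⟨h1, h2⟩, h4⟩, h3⟩, rfl⟩
    exact ⟨h1, b, h2, h3, h4⟩

/-- Compact-valued multifunction on `S`, with measurable hitting sets. -/
def AuxGood {E : Type*} [TopologicalSpace E] [MeasurableSpace E] (S : Set E) (M : E → Set E) :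
    Prop :=
  (∀ ξ ∈ S, IsCompact (M ξ) ∧ (M ξ).Nonempty ∧ M ξ ⊆ S) ∧
  ∀ F, IsClosed F → MeasurableSet {ξ | ξ ∈ S ∧ (M ξ ∩ F).Nonempty}

theorem aux_good_step {E : Type*} [TopologicalSpace E] [T2Space E] [MeasurableSpace E]
    {S : Set E} {M : E → Set E} (hSm : MeasurableSet S) (hM : AuxGood S M) {g : E → ℝ}
    (hg : Continuous g) :
    AuxGood S (fun ξ => {y | y ∈ M ξ ∧ ∀ z ∈ M ξ, g y ≤ g z}) := by
  refine ⟨fun ξ hξ => ?_, fun F hF => ?_⟩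
  · obtain ⟨hc, hne, hs⟩ := hM.1 ξ hξ
    refine ⟨?_, ?_, fun y hy => hs hy.1⟩
    · have : {y | y ∈ M ξ ∧ ∀ z ∈ M ξ, g y ≤ g z} = M ξ ∩ ⋂ z ∈ M ξ, {y | g y ≤ g z} := by
        ext y; simp
      show IsCompact {y | y ∈ M ξ ∧ ∀ z ∈ M ξ, g y ≤ g z}
      rw [this]
      exact hc.inter_right (isClosed_biInter fun z _ => isClosed_le hg continuous_const)
    · obtain ⟨y, hy, hy'⟩ := hc.exists_isMinOn hne hg.continuousOn
      exact ⟨y, hy, fun z hz => hy' hz⟩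
  · have : {ξ | ξ ∈ S ∧ ({y | y ∈ M ξ ∧ ∀ z ∈ M ξ, g y ≤ g z} ∩ F).Nonempty} =
        S ∩ ⋂ q : ℚ, ({ξ | ξ ∈ S ∧ (M ξ ∩ {y | g y ≤ q}).Nonempty}ᶜ ∪
          {ξ | ξ ∈ S ∧ (M ξ ∩ (F ∩ {y | g y ≤ q})).Nonempty}) := by
      ext ξ
      simp only [mem_ofPred_eq, mem_inter_iff, mem_iInter, mem_union, mem_compl_iff]
      constructor
      · rintro ⟨hξ, y, ⟨hy, hmin⟩, hyF⟩
        refine ⟨hξ, fun q => ?_⟩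
        by_cases hq : ∃ z ∈ M ξ, g z ≤ q
        · obtain ⟨z, hz, hzq⟩ := hq
          exact Or.inr ⟨hξ, y, hy, hyF, (hmin z hz).trans hzq⟩
        · left
          rintro ⟨_, z, hz, hzq⟩
          exact hq ⟨z, hz, hzq⟩
      · rintro ⟨hξ, hq⟩
        refine ⟨hξ, ?_⟩
        obtain ⟨hc, hne, hs⟩ := hM.1 ξ hξ
        obtain ⟨y, hy, hy'⟩ := hc.exists_isMinOn hne hg.continuousOn
        have key : ∀ q : ℚ, g y < q → ∃ z ∈ M ξ ∩ F, g z ≤ q := by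
          intro q hyq
          rcases hq q with h | ⟨_, z, hz, hzF, hzq⟩
          · exact absurd ⟨hξ, y, hy, hyq.le⟩ h
          · exact ⟨z, ⟨hz, hzF⟩, hzq⟩
        obtain ⟨q0, hq0⟩ := exists_rat_gt (g y)
        obtain ⟨z0, hz0, _⟩ := key q0 hq0
        obtain ⟨z, hz, hzmin⟩ := (hc.inter_right hF).exists_isMinOn ⟨z0, hz0⟩ hg.continuousOn
        have hzy : g z ≤ g y := by
          by_contra hlt
          push Not at hlt
          obtain ⟨q, h1, h2⟩ := exists_rat_btwn hlt
          obtain ⟨w, hw, hwq⟩ := key q h1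
          have := hzmin hw
          simp only [mem_ofPred_eq] at this
          linarith
        exact ⟨z, ⟨hz.1, fun w hw => hzy.trans (hy' hw)⟩, hz.2⟩
    rw [this]
    refine hSm.inter (MeasurableSet.iInter fun q => ?_)
    exact ((hM.2 _ (isClosed_le hg continuous_const)).compl).union
      (hM.2 _ (hF.inter (isClosed_le hg continuous_const)))

theorem aux_good_argmax {E : Type*} [TopologicalSpace E] [T2Space E] [MeasurableSpace E]
    [BorelSpace E] {S : Set E} (hS : IsCompact S) (hne : S.Nonempty)
    {h : E × E → ℝ} (hh : UpperSemicontinuousOn h (S ×ˢ S)) :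
    AuxGood S (fun ξ => {y | y ∈ S ∧ ∀ z ∈ S, h (ξ, z) ≤ h (ξ, y)}) := by
  have husc : ∀ ξ ∈ S, UpperSemicontinuousOn (fun y => h (ξ, y)) S := by
    intro ξ hξ
    exact UpperSemicontinuousOn.comp (f := h) (g := fun y => (ξ, y)) hh
      (by fun_prop) (fun y hy => ⟨hξ, hy⟩)
  refine ⟨fun ξ hξ => ?_, fun F hF => ?_⟩
  · obtain ⟨y, hy, hy'⟩ := (husc ξ hξ).exists_isMaxOn hne hS
    refine ⟨?_, ⟨y, hy, fun z hz => hy' hz⟩, fun y hy => hy.1⟩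
    have := (husc ξ hξ).isCompact_inter_preimage_Ici hS (h (ξ, y))
    convert this using 1
    ext w
    constructor
    · rintro ⟨h1, h2⟩
      exact ⟨h1, h2 y hy⟩
    · rintro ⟨h1, h2⟩
      exact ⟨h1, fun z hz => le_trans (hy' hz) h2⟩
  · have : {ξ | ξ ∈ S ∧ ({y | y ∈ S ∧ ∀ z ∈ S, h (ξ, z) ≤ h (ξ, y)} ∩ F).Nonempty} =
        S ∩ ⋂ q : ℚ, ({ξ | ξ ∈ S ∧ ∃ y ∈ S, y ∈ (univ : Set E) ∧ (q : ℝ) ≤ h (ξ, y)}ᶜ ∪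
          {ξ | ξ ∈ S ∧ ∃ y ∈ S, y ∈ F ∧ (q : ℝ) ≤ h (ξ, y)}) := by
      ext ξ
      simp only [mem_ofPred_eq, mem_inter_iff, mem_iInter, mem_union, mem_compl_iff]
      constructor
      · rintro ⟨hξ, y, ⟨hy, hmax⟩, hyF⟩
        refine ⟨hξ, fun q => ?_⟩
        by_cases hq : ∃ z ∈ S, (q : ℝ) ≤ h (ξ, z)
        · obtain ⟨z, hz, hzq⟩ := hq
          exact Or.inr ⟨hξ, y, hy, hyF, hzq.trans (hmax z hz)⟩
        · left
          rintro ⟨_, z, hz, _, hzq⟩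
          exact hq ⟨z, hz, hzq⟩
      · rintro ⟨hξ, hq⟩
        refine ⟨hξ, ?_⟩
        obtain ⟨y, hy, hy'⟩ := (husc ξ hξ).exists_isMaxOn hne hS
        have key : ∀ q : ℚ, (q : ℝ) < h (ξ, y) → ∃ z ∈ S ∩ F, (q : ℝ) ≤ h (ξ, z) := by
          intro q hyq
          rcases hq q with h | ⟨_, z, hz, hzF, hzq⟩
          · exact absurd ⟨hξ, y, hy, trivial, hyq.le⟩ h
          · exact ⟨z, ⟨hz, hzF⟩, hzq⟩
        obtain ⟨q0, hq0⟩ := exists_rat_lt (h (ξ, y))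
        obtain ⟨z0, hz0, _⟩ := key q0 hq0
        obtain ⟨z, hz, hzmax⟩ := ((husc ξ hξ).mono inter_subset_left).exists_isMaxOn ⟨z0, hz0⟩
          (hS.inter_right hF)
        have hzy : h (ξ, y) ≤ h (ξ, z) := by
          by_contra hlt
          push Not at hlt
          obtain ⟨q, h1, h2⟩ := exists_rat_btwn hlt
          obtain ⟨w, hw, hwq⟩ := key q h2
          have := hzmax hw
          simp only [mem_ofPred_eq] at this
          linarith
        exact ⟨z, ⟨hz.1, fun w hw => le_trans (hy' hw) hzy⟩, hz.2⟩
    rw [this]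
    refine hS.isClosed.measurableSet.inter (MeasurableSet.iInter fun q => ?_)
    exact ((aux_hit_closed hS hh isClosed_univ _).measurableSet.compl).union
      (aux_hit_closed hS hh hF _).measurableSet

theorem aux_selection {n : ℕ} {S : Set (Euc n)} (hS : IsCompact S) (hne : S.Nonempty)
    {h : Euc n × Euc n → ℝ} (hh : UpperSemicontinuousOn h (S ×ˢ S)) :
    ∃ T : Euc n → Euc n, Measurable T ∧ (∀ ξ, T ξ ∈ S) ∧
      ∀ ξ ∈ S, ∀ z ∈ S, h (ξ, z) ≤ h (ξ, T ξ) := by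
  have hSm := hS.isClosed.measurableSet
  have ind : ∀ k : ℕ, ∃ M : Euc n → Set (Euc n), AuxGood S M ∧
      (∀ ξ, M ξ ⊆ {y | y ∈ S ∧ ∀ z ∈ S, h (ξ, z) ≤ h (ξ, y)}) ∧
      ∀ ξ, ∀ y ∈ M ξ, ∀ z ∈ M ξ, ∀ i : Fin n, (i : ℕ) < k → y i = z i := by
    intro k
    induction k with
    | zero => exact ⟨_, aux_good_argmax hS hne hh, fun _ => subset_rfl, by simp⟩
    | succ k ih =>
      obtain ⟨M, hM, hsub, huniq⟩ := ih
      by_cases hk : k < n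
      · refine ⟨_, aux_good_step hSm hM (g := fun y => y ⟨k, hk⟩) (by fun_prop),
          fun ξ y hy => hsub ξ hy.1, ?_⟩
        intro ξ y hy z hz i hi
        rcases Nat.lt_succ_iff_lt_or_eq.mp hi with h | h
        · exact huniq ξ y hy.1 z hz.1 i h
        · have : i = ⟨k, hk⟩ := Fin.ext h
          rw [this]
          exact le_antisymm (hy.2 z hz.1) (hz.2 y hy.1)
      · exact ⟨M, hM, hsub, fun ξ y hy z hz i _ => huniq ξ y hy z hz i (by omega)⟩
  obtain ⟨M, hM, hsub, huniq⟩ := ind n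
  obtain ⟨s0, hs0⟩ := hne
  have hex : ∀ ξ, ∃ t, (ξ ∈ S → t ∈ M ξ) ∧ (ξ ∉ S → t = s0) := by
    intro ξ
    by_cases hξ : ξ ∈ S
    · obtain ⟨t, ht⟩ := (hM.1 ξ hξ).2.1
      exact ⟨t, fun _ => ht, fun h => absurd hξ h⟩
    · exact ⟨s0, fun h => absurd h hξ, fun _ => rfl⟩
  choose T hT1 hT2 using hex
  refine ⟨T, ?_, fun ξ => ?_, fun ξ hξ => (hsub ξ (hT1 ξ hξ)).2⟩
  · refine measurable_of_isClosed fun F hF => ?_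
    have : T ⁻¹' F = {ξ | ξ ∈ S ∧ (M ξ ∩ F).Nonempty} ∪ (Sᶜ ∩ {_ξ | s0 ∈ F}) := by
      ext ξ
      by_cases hξ : ξ ∈ S
      · simp only [mem_preimage, mem_union, mem_ofPred_eq, hξ, true_and, mem_inter_iff,
          mem_compl_iff, not_true_eq_false, false_and, or_false]
        constructor
        · intro h
          exact ⟨_, hT1 ξ hξ, h⟩
        · rintro ⟨y, hy, hyF⟩
          have : T ξ = y := by
            ext i
            exact huniq ξ _ (hT1 ξ hξ) y hy i i.2
          rwa [this]
      · simp [hξ, hT2 ξ hξ]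
    rw [this]
    exact (hM.2 F hF).union (hSm.compl.inter (MeasurableSet.const _))
  · by_cases hξ : ξ ∈ S
    · exact (hsub ξ (hT1 ξ hξ)).1
    · rw [hT2 ξ hξ]; exact hs0

theorem aux_supergradient {A : Set (ℝ × ℝ)} (hA : Convex ℝ A) {ε v b0 : ℝ} (hε : 0 < ε)
    (h0 : ((0 : ℝ), b0) ∈ A) (hv : ∀ p ∈ A, p.1 ≤ ε → p.2 ≤ v) :
    ∃ γ : ℝ, 0 ≤ γ ∧ ∀ p ∈ A, p.2 ≤ v + γ * (p.1 - ε) := by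
  let G : Set ℝ := insert 0 {g | ∃ p ∈ A, ε < p.1 ∧ g = (p.2 - v) / (p.1 - ε)}
  have key : ∀ p ∈ A, p.1 < ε → ∀ g ∈ G, g ≤ (v - p.2) / (ε - p.1) := by
    intro p hp hpε g hg
    have h1 : 0 < ε - p.1 := by linarith
    have h2 : p.2 ≤ v := hv p hp hpε.le
    rcases hg with rfl | ⟨p', hp', hp'ε, rfl⟩
    · exact div_nonneg (by linarith) h1.le
    · have h3 : 0 < p'.1 - ε := by linarith
      have h4 : 0 < p'.1 - p.1 := by linarith
      have hmem := hA hp hp' (a := (p'.1 - ε) / (p'.1 - p.1)) (b := (ε - p.1) / (p'.1 - p.1))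
        (by positivity) (by positivity) (by field_simp; ring)
      have h5 := hv _ hmem (by
        simp only [Prod.fst_add, Prod.smul_fst, smul_eq_mul]
        apply le_of_eq
        field_simp
        ring)
      simp only [Prod.snd_add, Prod.smul_snd, smul_eq_mul] at h5
      have h6 : (p'.1 - ε) * p.2 + (ε - p.1) * p'.2 ≤ v * (p'.1 - p.1) := by
        have := mul_le_mul_of_nonneg_right h5 h4.le
        calc _ = ((p'.1 - ε) / (p'.1 - p.1) * p.2 + (ε - p.1) / (p'.1 - p.1) * p'.2)
              * (p'.1 - p.1) := by field_simp
          _ ≤ _ := this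
      rw [div_le_div_iff₀ h3 h1]
      nlinarith
  have hbdd : BddAbove G := ⟨_, fun g hg => key _ h0 hε g hg⟩
  refine ⟨sSup G, le_csSup hbdd (mem_insert _ _), fun p hp => ?_⟩
  rcases lt_trichotomy p.1 ε with h | h | h
  · have h1 : 0 < ε - p.1 := by linarith
    have h2 : sSup G ≤ (v - p.2) / (ε - p.1) := csSup_le ⟨0, mem_insert _ _⟩ (key p hp h)
    rw [le_div_iff₀ h1] at h2
    linarith
  · rw [h]
    have := hv p hp h.le
    linarith
  · have h1 : 0 < p.1 - ε := by linarith
    have h2 : (p.2 - v) / (p.1 - ε) ≤ sSup G := le_csSup hbdd (Or.inr ⟨p, hp, h, rfl⟩)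
    rw [div_le_iff₀ h1] at h2
    linarith

theorem aux_integrable {α : Type*} [MeasurableSpace α] {μ : Measure α} [IsFiniteMeasure μ]
    {f : α → ℝ} (hf : Measurable f) {B : ℝ} (h0 : ∀ x, 0 ≤ f x) (hB : ∀ x, f x ≤ B) :
    Integrable f μ :=
  Integrable.of_bound hf.aestronglyMeasurable B
    (Eventually.of_forall fun x => by rw [Real.norm_of_nonneg (h0 x)]; exact hB x)

theorem aux_prob_of_map {α β : Type*} [MeasurableSpace α] [MeasurableSpace β] {π : Measure α}
    {μ : Measure β} [IsProbabilityMeasure μ] {f : α → β} (hf : Measurable f)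
    (h : π.map f = μ) : IsProbabilityMeasure π := by
  constructor
  have h1 : μ univ = 1 := measure_univ
  rwa [← h, Measure.map_apply hf MeasurableSet.univ, preimage_univ] at h1

theorem aux_strong {E : Type*} [MeasurableSpace E] {S : Set E}
    (hSm : MeasurableSet S) (μ : Measure E) [IsProbabilityMeasure μ] (hμ : μ Sᶜ = 0)
    {c : E × E → ℝ} (hc : Measurable c) {D : ℝ} (hc0 : ∀ p, 0 ≤ c p) (hcD : ∀ p, c p ≤ D)
    (hcd : ∀ ξ, c (ξ, ξ) = 0)
    {l : E → ℝ} (hl : Measurable l) {B : ℝ} (hl0 : ∀ p, 0 ≤ l p) (hlB : ∀ p, l p ≤ B)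
    {ε v : ℝ} (hε : 0 < ε)
    (hv : ∀ π : Measure (E × E), π.map Prod.fst = μ → π (S ×ˢ S)ᶜ = 0 → ∫ p, c p ∂π ≤ ε →
      ∫ p, l p.2 ∂π ≤ v) :
    ∃ γ : ℝ, 0 ≤ γ ∧ ∀ T : E → E, Measurable T → (∀ ξ, T ξ ∈ S) →
      ∫ ξ, (l (T ξ) - γ * c (ξ, T ξ)) ∂μ + ε * γ ≤ v := by
  let A : Set (ℝ × ℝ) := {q | ∃ π : Measure (E × E), π.map Prod.fst = μ ∧ π (S ×ˢ S)ᶜ = 0 ∧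
    q.1 = ∫ p, c p ∂π ∧ q.2 = ∫ p, l p.2 ∂π}
  have hSS : MeasurableSet (S ×ˢ S)ᶜ := (hSm.prod hSm).compl
  have hA : Convex ℝ A := by
    rintro q ⟨π, h1, h2, h3, h4⟩ q' ⟨π', h1', h2', h3', h4'⟩ s t hs ht hst
    have := aux_prob_of_map measurable_fst h1
    have := aux_prob_of_map measurable_fst h1'
    have i1 : Integrable c (ENNReal.ofReal s • π) :=
      (aux_integrable hc hc0 hcD).smul_measure ENNReal.ofReal_ne_top
    have i2 : Integrable c (ENNReal.ofReal t • π') :=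
      (aux_integrable hc hc0 hcD).smul_measure ENNReal.ofReal_ne_top
    have hl2 : Measurable (fun p : E × E => l p.2) := hl.comp measurable_snd
    have i3 : Integrable (fun p : E × E => l p.2) (ENNReal.ofReal s • π) :=
      (aux_integrable hl2 (fun p => hl0 _) (fun p => hlB _)).smul_measure ENNReal.ofReal_ne_top
    have i4 : Integrable (fun p : E × E => l p.2) (ENNReal.ofReal t • π') :=
      (aux_integrable hl2 (fun p => hl0 _) (fun p => hlB _)).smul_measure ENNReal.ofReal_ne_top
    refine ⟨ENNReal.ofReal s • π + ENNReal.ofReal t • π', ?_, ?_, ?_, ?_⟩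
    · rw [Measure.map_add _ _ measurable_fst, Measure.map_smul, Measure.map_smul, h1, h1',
        ← add_smul, ← ENNReal.ofReal_add hs ht, hst]
      simp
    · simp [h2, h2']
    · rw [integral_add_measure i1 i2, integral_smul_measure, integral_smul_measure,
        ENNReal.toReal_ofReal hs, ENNReal.toReal_ofReal ht, ← h3, ← h3']
      simp
    · rw [integral_add_measure i3 i4, integral_smul_measure, integral_smul_measure,
        ENNReal.toReal_ofReal hs, ENNReal.toReal_ofReal ht, ← h4, ← h4']
      simp
  have hmap : ∀ T : E → E, Measurable T → (∀ᵐ ξ ∂μ, T ξ ∈ S) →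
      (∫ ξ, c (ξ, T ξ) ∂μ, ∫ ξ, l (T ξ) ∂μ) ∈ A := by
    intro T hT hTS
    have hm : Measurable (fun ξ => (ξ, T ξ)) := measurable_id.prodMk hT
    refine ⟨μ.map (fun ξ => (ξ, T ξ)), ?_, ?_, ?_, ?_⟩
    · rw [Measure.map_map measurable_fst hm]
      exact Measure.map_id
    · rw [Measure.map_apply hm hSS]
      have hμ' : ∀ᵐ ξ ∂μ, ξ ∈ S := hμ
      have : ∀ᵐ ξ ∂μ, (ξ, T ξ) ∈ S ×ˢ S := by
        filter_upwards [hμ', hTS] with ξ h1 h2 using ⟨h1, h2⟩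
      exact this
    · rw [integral_map hm.aemeasurable hc.aestronglyMeasurable]
    · have hl2 : Measurable (fun p : E × E => l p.2) := hl.comp measurable_snd
      rw [integral_map hm.aemeasurable hl2.aestronglyMeasurable]
  have h0 : ((0 : ℝ), ∫ ξ, l ξ ∂μ) ∈ A := by
    have := hmap id measurable_id hμ
    simpa [hcd] using this
  obtain ⟨γ, hγ, hγA⟩ := aux_supergradient hA hε h0 (v := v) (by
    rintro q ⟨π, h1, h2, h3, h4⟩ hq
    rw [h4]
    exact hv π h1 h2 (h3 ▸ hq))
  refine ⟨γ, hγ, fun T hT hTS => ?_⟩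
  have h1 := hγA _ (hmap T hT (Eventually.of_forall hTS))
  have hm : Measurable (fun ξ => (ξ, T ξ)) := measurable_id.prodMk hT
  have i1 : Integrable (fun ξ => l (T ξ)) μ :=
    aux_integrable (hl.comp hT) (fun _ => hl0 _) (fun _ => hlB _)
  have i2 : Integrable (fun ξ => c (ξ, T ξ)) μ :=
    aux_integrable (hc.comp hm) (fun _ => hc0 _) (fun _ => hcD _)
  rw [integral_sub i1 (i2.const_mul γ), integral_const_mul]
  simp only at h1
  linarith

theorem aux_grid {D ε δ : ℝ} {K : ℕ} (hK : 1 ≤ K) (hε : 0 < ε) (hεD : ε ≤ D)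
    (h0 : 0 ≤ δ) (hD : δ ≤ D) :
    ∃ δ' ∈ Dro.deltaGrid D ε K, δ ≤ δ' ∧ δ' ≤ (D / ε) ^ ((1 : ℝ) / K) * δ + ε / K := by
  have hK0 : (0 : ℝ) < K := by exact_mod_cast hK
  have hr : 1 ≤ D / ε := (one_le_div hε).mpr hεD
  have hρ : 1 ≤ (D / ε) ^ ((1 : ℝ) / K) := Real.one_le_rpow hr (by positivity)
  rcases le_or_gt δ ε with h | h
  · have hk : ⌈δ * K / ε⌉₊ ≤ K := by
      rw [Nat.ceil_le, div_le_iff₀ hε]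
      nlinarith
    refine ⟨ε * (⌈δ * K / ε⌉₊ : ℕ) / K, Or.inl ⟨⟨_, Nat.lt_succ_of_le hk⟩, trivial, rfl⟩, ?_, ?_⟩
    · have := Nat.le_ceil (δ * K / ε)
      rw [div_le_iff₀ hε] at this
      rw [le_div_iff₀ hK0]
      linarith
    · have h1 := (Nat.ceil_lt_add_one (show 0 ≤ δ * K / ε by positivity)).le
      have h2 : ε * (⌈δ * K / ε⌉₊ : ℕ) / K ≤ ε * (δ * K / ε + 1) / K := by gcongr
      have h3 : ε * (δ * K / ε + 1) / K = δ + ε / K := by field_simp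
      nlinarith
  · have hex : ∃ k : ℕ, δ ≤ ε * (D / ε) ^ ((k : ℝ) / K) := by
      refine ⟨K, ?_⟩
      rw [div_self hK0.ne', Real.rpow_one]
      field_simp
      exact hD
    classical
    have hkK : Nat.find hex ≤ K := by
      apply Nat.find_min'
      rw [div_self hK0.ne', Real.rpow_one]
      field_simp
      exact hD
    have hspec := Nat.find_spec hex
    refine ⟨_, Or.inr ⟨⟨Nat.find hex, Nat.lt_succ_of_le hkK⟩, trivial, rfl⟩, hspec, ?_⟩
    have hpos : Nat.find hex ≠ 0 := by
      intro h'
      rw [h'] at hspec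
      simp at hspec
      linarith
    obtain ⟨m, hm⟩ := Nat.exists_eq_succ_of_ne_zero hpos
    have hlt := Nat.find_min hex (m := m) (by omega)
    push Not at hlt
    simp only [hm]
    have e : (D / ε) ^ (((m.succ : ℕ) : ℝ) / K) = (D / ε) ^ ((1 : ℝ) / K) * (D / ε) ^ ((m : ℝ) / K) := by
      rw [← Real.rpow_add (by linarith)]
      congr 1
      push_cast
      ring
    rw [e]
    have : 0 < ε / K := by positivity
    nlinarith

theorem aux_grid_nonneg {D ε δ : ℝ} {K : ℕ} (hε : 0 < ε) (hεD : ε ≤ D)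
    (h : δ ∈ Dro.deltaGrid D ε K) : 0 ≤ δ := by
  have : 0 ≤ D := by linarith
  rcases h with ⟨k, _, rfl⟩ | ⟨k, _, rfl⟩ <;> positivity

theorem aux_grid_zero {D ε : ℝ} {K : ℕ} : 0 ∈ Dro.deltaGrid D ε K :=
  Or.inl ⟨0, trivial, by simp⟩

theorem aux_grid_finite {D ε : ℝ} {K : ℕ} : (Dro.deltaGrid D ε K).Finite :=
  (finite_univ.image _).union (finite_univ.image _)

section AuxMain

variable {n : ℕ} {X : Type*} {S : Set (Euc n)} {c : Euc n → Euc n → ℝ} {ℓ : X → Euc n → ℝ} {x : X}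

theorem aux_linfl_bdd {B : ℝ} (hB : ∀ ξ ∈ S, ℓ x ξ ≤ B) (δ : ℝ) (ξ : Euc n) :
    BddAbove {u | ∃ ξ' ∈ S, c ξ ξ' ≤ δ ∧ u = ℓ x ξ'} := by
  refine ⟨B, ?_⟩
  rintro u ⟨ξ', h1, _, rfl⟩
  exact hB ξ' h1

theorem aux_le_linfl {B : ℝ} (hB : ∀ ξ ∈ S, ℓ x ξ ≤ B) {δ : ℝ} {ξ ξ' : Euc n} (h1 : ξ' ∈ S)
    (h2 : c ξ ξ' ≤ δ) : ℓ x ξ' ≤ Dro.linfl S c ℓ δ x ξ :=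
  le_csSup (aux_linfl_bdd hB δ ξ) ⟨ξ', h1, h2, rfl⟩

theorem aux_linfl_le (hc0 : ∀ ξ ∈ S, c ξ ξ = 0) {δ : ℝ} (hδ : 0 ≤ δ) {ξ : Euc n} (hξ : ξ ∈ S)
    {u : ℝ} (h : ∀ ξ' ∈ S, c ξ ξ' ≤ δ → ℓ x ξ' ≤ u) : Dro.linfl S c ℓ δ x ξ ≤ u := by
  refine csSup_le ⟨_, ξ, hξ, (hc0 ξ hξ).trans_le hδ, rfl⟩ ?_
  rintro w ⟨ξ', h1, h2, rfl⟩
  exact h ξ' h1 h2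

theorem aux_linfl_iff (hS : IsCompact S)
    (hclsc : LowerSemicontinuousOn (fun p : Euc n × Euc n => c p.1 p.2) (S ×ˢ S))
    (hc0 : ∀ ξ ∈ S, c ξ ξ = 0) (husc : UpperSemicontinuousOn (ℓ x) S)
    {B : ℝ} (hB : ∀ ξ ∈ S, ℓ x ξ ≤ B) {δ : ℝ} (hδ : 0 ≤ δ) {ξ : Euc n} (hξ : ξ ∈ S) (q : ℝ) :
    q ≤ Dro.linfl S c ℓ δ x ξ ↔ ∃ ξ' ∈ S, c ξ ξ' ≤ δ ∧ q ≤ ℓ x ξ' := by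
  constructor
  · intro h
    have h1 : LowerSemicontinuousOn (fun y => c ξ y) S :=
      LowerSemicontinuousOn.comp (f := fun p : Euc n × Euc n => c p.1 p.2)
        (g := fun y => (ξ, y)) hclsc (by fun_prop) (fun y hy => ⟨hξ, hy⟩)
    have h2 := h1.isCompact_inter_preimage_Iic hS δ
    have hne : (S ∩ (fun y => c ξ y) ⁻¹' Iic δ).Nonempty := ⟨ξ, hξ, (hc0 ξ hξ).trans_le hδ⟩
    obtain ⟨y, hy, hy'⟩ := (husc.mono (inter_subset_left)).exists_isMaxOn hne h2
    refine ⟨y, hy.1, hy.2, h.trans ?_⟩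
    exact aux_linfl_le hc0 hδ hξ fun ξ' h3 h4 => hy' ⟨h3, h4⟩
  · rintro ⟨ξ', h1, h2, h3⟩
    exact h3.trans (aux_le_linfl hB h1 h2)

theorem aux_linfl_meas (hS : IsCompact S)
    (hclsc : LowerSemicontinuousOn (fun p : Euc n × Euc n => c p.1 p.2) (S ×ˢ S))
    (hc0 : ∀ ξ ∈ S, c ξ ξ = 0) (husc : UpperSemicontinuousOn (ℓ x) S)
    {B : ℝ} (hB : ∀ ξ ∈ S, ℓ x ξ ≤ B) {δ : ℝ} (hδ : 0 ≤ δ) (q : ℝ) :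
    MeasurableSet {ξ | ξ ∈ S ∧ q ≤ Dro.linfl S c ℓ δ x ξ} := by
  have h1 := hclsc.isCompact_inter_preimage_Iic (hS.prod hS) δ
  have h2 := (husc.isCompact_inter_preimage_Ici hS q).isClosed
  have h3 := (h1.inter_right (h2.preimage continuous_snd)).image continuous_fst
  convert h3.isClosed.measurableSet using 1
  ext ξ
  constructor
  · rintro ⟨hξ, h⟩
    obtain ⟨ξ', h4, h5, h6⟩ := (aux_linfl_iff hS hclsc hc0 husc hB hδ hξ q).mp h
    exact ⟨(ξ, ξ'), ⟨⟨⟨hξ, h4⟩, h5⟩, h4, h6⟩, rfl⟩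
  · rintro ⟨⟨a, b⟩, ⟨⟨⟨hξ, h4⟩, h5⟩, _, h6⟩, rfl⟩
    exact ⟨hξ, (aux_linfl_iff hS hclsc hc0 husc hB hδ hξ q).mpr ⟨b, h4, h5, h6⟩⟩

/-- The discretized dual integrand. -/
def auxPsi (S : Set (Euc n)) (c : Euc n → Euc n → ℝ) (ℓ : X → Euc n → ℝ) (ε : ℝ) (K : ℕ) (x : X)
    (γ : ℝ) (ξ : Euc n) : ℝ :=
  sSup {u | ∃ δ ∈ Dro.deltaGrid (Metric.diam S) ε K, u = Dro.linfl S c ℓ δ x ξ - γ * δ}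

theorem aux_psi_finite (ε : ℝ) (K : ℕ) (γ : ℝ) (ξ : Euc n) :
    {u | ∃ δ ∈ Dro.deltaGrid (Metric.diam S) ε K, u = Dro.linfl S c ℓ δ x ξ - γ * δ}.Finite := by
  refine ((aux_grid_finite (D := Metric.diam S) (ε := ε) (K := K)).image (fun δ => Dro.linfl S c ℓ δ x ξ - γ * δ)).subset ?_
  rintro u ⟨δ, h, rfl⟩
  exact ⟨δ, h, rfl⟩

theorem aux_psi_iff (ε : ℝ) (K : ℕ) (γ : ℝ) (ξ : Euc n) (q : ℝ) :
    q ≤ auxPsi S c ℓ ε K x γ ξ ↔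
      ∃ δ ∈ Dro.deltaGrid (Metric.diam S) ε K, q ≤ Dro.linfl S c ℓ δ x ξ - γ * δ := by
  have hf := aux_psi_finite (S := S) (c := c) (ℓ := ℓ) (x := x) ε K γ ξ
  constructor
  · intro h
    have hne : {u | ∃ δ ∈ Dro.deltaGrid (Metric.diam S) ε K,
        u = Dro.linfl S c ℓ δ x ξ - γ * δ}.Nonempty := ⟨_, 0, aux_grid_zero, rfl⟩
    obtain ⟨δ, h1, h2⟩ := hne.csSup_mem hf
    exact ⟨δ, h1, h.trans h2.le⟩
  · rintro ⟨δ, h1, h2⟩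
    exact h2.trans (le_csSup hf.bddAbove ⟨δ, h1, rfl⟩)

theorem aux_psi_meas (hS : IsCompact S)
    (hclsc : LowerSemicontinuousOn (fun p : Euc n × Euc n => c p.1 p.2) (S ×ˢ S))
    (hc0 : ∀ ξ ∈ S, c ξ ξ = 0) (husc : UpperSemicontinuousOn (ℓ x) S)
    {B : ℝ} (hB : ∀ ξ ∈ S, ℓ x ξ ≤ B) {ε : ℝ} (hε : 0 < ε) (hεD : ε ≤ Metric.diam S) (K : ℕ)
    (γ : ℝ) : Measurable (S.indicator (auxPsi S c ℓ ε K x γ)) := by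
  refine aux_meas_indicator hS.isClosed.measurableSet fun q => ?_
  have : {ξ | ξ ∈ S ∧ q ≤ auxPsi S c ℓ ε K x γ ξ} =
      ⋃ δ ∈ Dro.deltaGrid (Metric.diam S) ε K,
        {ξ | ξ ∈ S ∧ q + γ * δ ≤ Dro.linfl S c ℓ δ x ξ} := by
    ext ξ
    simp only [mem_ofPred_eq, mem_iUnion, aux_psi_iff, exists_prop]
    constructor
    · rintro ⟨h1, δ, h2, h3⟩
      exact ⟨δ, h2, h1, by linarith⟩
    · rintro ⟨δ, h2, h1, h3⟩
      exact ⟨h1, δ, h2, by linarith⟩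
  rw [this]
  exact aux_grid_finite.measurableSet_biUnion fun δ hδ =>
    aux_linfl_meas hS hclsc hc0 husc hB (aux_grid_nonneg hε hεD hδ) _

theorem aux_psi_nonneg (hc0 : ∀ ξ ∈ S, c ξ ξ = 0) (h0 : ∀ ξ ∈ S, 0 ≤ ℓ x ξ)
    {B : ℝ} (hB : ∀ ξ ∈ S, ℓ x ξ ≤ B) (ε : ℝ) (K : ℕ) (γ : ℝ) {ξ : Euc n} (hξ : ξ ∈ S) :
    0 ≤ auxPsi S c ℓ ε K x γ ξ := by
  rw [aux_psi_iff]
  refine ⟨0, aux_grid_zero, ?_⟩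
  have := aux_le_linfl (c := c) hB hξ (hc0 ξ hξ).le
  have := h0 ξ hξ
  linarith

theorem aux_psi_le (hc0 : ∀ ξ ∈ S, c ξ ξ = 0) {ε : ℝ} (hε : 0 < ε) (hεD : ε ≤ Metric.diam S)
    (K : ℕ) {γ : ℝ} (hγ : 0 ≤ γ) {ξ : Euc n} (hξ : ξ ∈ S) {u : ℝ}
    (hu : ∀ ξ' ∈ S, ℓ x ξ' - γ * c ξ ξ' ≤ u) :
    auxPsi S c ℓ ε K x γ ξ ≤ u := by
  obtain ⟨δ, hδ, h1⟩ := (aux_psi_iff (S := S) (c := c) (ℓ := ℓ) (x := x) ε K γ ξ _).mp le_rfl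
  refine h1.trans ?_
  have : Dro.linfl S c ℓ δ x ξ ≤ u + γ * δ := by
    refine aux_linfl_le hc0 (aux_grid_nonneg hε hεD hδ) hξ fun ξ' h2 h3 => ?_
    have := hu ξ' h2
    have := mul_le_mul_of_nonneg_left h3 hγ
    linarith
  linarith

theorem aux_disc (hcnn : ∀ ξ ∈ S, ∀ ξ' ∈ S, 0 ≤ c ξ ξ')
    (hcub : ∀ ξ ∈ S, ∀ ξ' ∈ S, c ξ ξ' ≤ Metric.diam S)
    {B : ℝ} (hB : ∀ ξ ∈ S, ℓ x ξ ≤ B) {ε : ℝ} (hε : 0 < ε) (hεD : ε ≤ Metric.diam S)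
    {K : ℕ} (hK : 1 ≤ K) {γ : ℝ} (hγ : 0 ≤ γ) {ξ ξ' : Euc n} (hξ : ξ ∈ S) (hξ' : ξ' ∈ S) :
    ℓ x ξ' ≤ auxPsi S c ℓ ε K x γ ξ +
      γ * (Metric.diam S / ε) ^ ((1 : ℝ) / K) * c ξ ξ' + γ * (ε / K) := by
  obtain ⟨δ, hδ, h1, h2⟩ := aux_grid hK hε hεD (hcnn ξ hξ ξ' hξ') (hcub ξ hξ ξ' hξ')
  have h3 := aux_le_linfl (ℓ := ℓ) (x := x) hB hξ' h1
  have h4 : Dro.linfl S c ℓ δ x ξ - γ * δ ≤ auxPsi S c ℓ ε K x γ ξ :=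
    (aux_psi_iff ε K γ ξ _).mpr ⟨δ, hδ, le_rfl⟩
  have h5 := mul_le_mul_of_nonneg_left h2 hγ
  linarith

end AuxMain

/-- Proposition: discretization of transport-based DRO.
Let `Σ ⊂ ℝ^d` be compact, `d` a lower semicontinuous transport cost with `d(ξ,ξ) = 0` and
values in `[0, diam Σ]`, and `ℓ(x,·)` nonnegative and upper semicontinuous on `Σ`.  For
`ε ∈ (0, diam Σ]` and `K ≥ 1`,
`ĉ^K_{d,ε}(x,P̂) ≤ ĉ_{d,ε}(x,P̂) ≤ ((diam Σ/ε)^{1/K} + 1/K) · ĉ^K_{d,ε}(x,P̂)`. -/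
theorem discretized_transport_dro_bounds
    {n : ℕ} {X : Type*} [Nonempty X]
    (S : Set (Euc n)) (hS : IsCompact S)
    (c : Euc n → Euc n → ℝ)
    (hclsc : LowerSemicontinuousOn (fun p : Euc n × Euc n => c p.1 p.2) (S ×ˢ S))
    (hc0 : ∀ ξ ∈ S, c ξ ξ = 0)
    (hcnn : ∀ ξ ∈ S, ∀ ξ' ∈ S, 0 ≤ c ξ ξ')
    (hcub : ∀ ξ ∈ S, ∀ ξ' ∈ S, c ξ ξ' ≤ Metric.diam S)
    (ℓ : X → Euc n → ℝ) (husc : ∀ x, UpperSemicontinuousOn (ℓ x) S)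
    (h0 : ∀ x, ∀ ξ ∈ S, 0 ≤ ℓ x ξ)
    (ε : ℝ) (hε : ε ∈ Set.Ioc (0:ℝ) (Metric.diam S)) (K : ℕ) (hK : 1 ≤ K)
    (x : X) (Phat : MeasureTheory.ProbabilityMeasure (Euc n)) (hPhat : Phat ∈ Dro.PMOn S) :
    Dro.cTransK S c ℓ ε K x Phat ≤ Dro.cTrans S c ℓ ε x Phat ∧
    Dro.cTrans S c ℓ ε x Phat
      ≤ ((Metric.diam S / ε) ^ ((1:ℝ) / (K:ℝ)) + 1 / (K:ℝ)) * Dro.cTransK S c ℓ ε K x Phat := by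
  classical
  obtain ⟨hε0, hεD⟩ := hε
  have hSm : MeasurableSet S := hS.isClosed.measurableSet
  have hSSm : MeasurableSet (S ×ˢ S) := hSm.prod hSm
  have hμS : (Phat : Measure (Euc n)) Sᶜ = 0 := (prob_compl_eq_zero_iff hSm).mpr hPhat
  have hμae : ∀ᵐ ξ ∂(Phat : Measure (Euc n)), ξ ∈ S := hμS
  have hne : S.Nonempty := by
    rw [nonempty_iff_ne_empty]
    rintro rfl
    simp at hεD
    linarith
  obtain ⟨ym, hym, hmax⟩ := (husc x).exists_isMaxOn hne hS
  set B : ℝ := ℓ x ym with hBdef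
  have hB : ∀ ξ ∈ S, ℓ x ξ ≤ B := fun ξ hξ => hmax hξ
  have hB0 : 0 ≤ B := h0 x ym hym
  have hD0 : 0 ≤ Metric.diam S := Metric.diam_nonneg
  let l' : Euc n → ℝ := S.indicator (ℓ x)
  let c' : Euc n × Euc n → ℝ := (S ×ˢ S).indicator (fun p => c p.1 p.2)
  have hl'm : Measurable l' := aux_meas_indicator hSm fun q =>
    ((husc x).isCompact_inter_preimage_Ici hS q).isClosed.measurableSet
  have hc'm : Measurable c' := by
    have : Measurable ((S ×ˢ S).indicator (fun p : Euc n × Euc n => - c p.1 p.2)) := by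
      refine aux_meas_indicator hSSm fun q => ?_
      have h1 := (hclsc.isCompact_inter_preimage_Iic (hS.prod hS) (-q)).isClosed.measurableSet
      convert h1 using 1
      ext p
      constructor
      · rintro ⟨h1, h2⟩
        exact ⟨h1, by simp only [mem_preimage, mem_Iic]; linarith⟩
      · rintro ⟨h1, h2⟩
        simp only [mem_preimage, mem_Iic] at h2
        exact ⟨h1, by linarith⟩
    have h2 : c' = fun p => - ((S ×ˢ S).indicator (fun p : Euc n × Euc n => - c p.1 p.2) p) := by
      ext p
      by_cases hp : p ∈ S ×ˢ S
      · simp only [c', indicator_of_mem hp, neg_neg]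
      · simp only [c', indicator_of_notMem hp, neg_zero]
    rw [h2]
    exact this.neg
  have hl'0 : ∀ ξ, 0 ≤ l' ξ := fun ξ => indicator_nonneg (fun ξ hξ => h0 x ξ hξ) ξ
  have hl'B : ∀ ξ, l' ξ ≤ B := fun ξ => indicator_le' (fun ξ hξ => hB ξ hξ) (fun _ _ => hB0) ξ
  have hc'0 : ∀ p, 0 ≤ c' p := fun p =>
    indicator_nonneg (fun p hp => hcnn p.1 hp.1 p.2 hp.2) p
  have hc'D : ∀ p, c' p ≤ Metric.diam S := fun p =>
    indicator_le' (fun p hp => hcub p.1 hp.1 p.2 hp.2) (fun _ _ => hD0) p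
  have hc'd : ∀ ξ, c' (ξ, ξ) = 0 := by
    intro ξ
    by_cases hξ : ξ ∈ S
    · simp only [c']
      rw [indicator_of_mem (show (ξ, ξ) ∈ S ×ˢ S from ⟨hξ, hξ⟩)]
      exact hc0 ξ hξ
    · simp only [c']
      rw [indicator_of_notMem]
      exact fun h => hξ h.1
  have hcost : ∀ P ∈ Dro.PMOn S, Dro.cost ℓ x P = ∫ ξ, l' ξ ∂(P : Measure (Euc n)) := by
    intro P hP
    have hae : ∀ᵐ ξ ∂(P : Measure (Euc n)), ξ ∈ S := (prob_compl_eq_zero_iff hSm).mpr hP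
    refine integral_congr_ae ?_
    filter_upwards [hae] with ξ hξ
    simp only [l', indicator_of_mem hξ]
  have hcostB : ∀ P ∈ Dro.PMOn S, Dro.cost ℓ x P ≤ B := by
    intro P hP
    rw [hcost P hP]
    calc _ ≤ ∫ ξ, B ∂(P : Measure (Euc n)) :=
          integral_mono (aux_integrable hl'm hl'0 hl'B) (integrable_const _) hl'B
      _ = B := by simp
  have hlint : ∀ π : Measure (Euc n × Euc n), IsProbabilityMeasure π → π (S ×ˢ S)ᶜ = 0 →
      ∫⁻ p, ENNReal.ofReal (c p.1 p.2) ∂π = ENNReal.ofReal (∫ p, c' p ∂π) := by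
    intro π _ hπ
    have hae : ∀ᵐ p ∂π, p ∈ S ×ˢ S := hπ
    rw [ofReal_integral_eq_lintegral_ofReal (aux_integrable hc'm hc'0 hc'D)
      (Eventually.of_forall hc'0)]
    refine lintegral_congr_ae ?_
    filter_upwards [hae] with p hp
    simp only [c', indicator_of_mem hp]
  set V : Set ℝ := {v | ∃ P ∈ Dro.PMOn S,
    Dro.wCost c (Phat : Measure (Euc n)) (P : Measure (Euc n)) ≤ ENNReal.ofReal ε ∧
      v = Dro.cost ℓ x P} with hV
  have hVbdd : BddAbove V := by
    refine ⟨B, ?_⟩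
    rintro v ⟨P, hP, _, rfl⟩
    exact hcostB P hP
  have hprimal : ∀ π : Measure (Euc n × Euc n), π.map Prod.fst = (Phat : Measure (Euc n)) →
      π (S ×ˢ S)ᶜ = 0 → ∫ p, c' p ∂π ≤ ε →
      ∃ P : ProbabilityMeasure (Euc n), P ∈ Dro.PMOn S ∧
        Dro.wCost c (Phat : Measure (Euc n)) (P : Measure (Euc n)) ≤ ENNReal.ofReal ε ∧
        ∫ p, l' p.2 ∂π = Dro.cost ℓ x P := by
    intro π h1 h2 h3
    have hπ := aux_prob_of_map measurable_fst h1
    have hPp : IsProbabilityMeasure (π.map Prod.snd) :=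
      Measure.isProbabilityMeasure_map measurable_snd.aemeasurable
    have hPS : (⟨π.map Prod.snd, hPp⟩ : ProbabilityMeasure (Euc n)) ∈ Dro.PMOn S := by
      show π.map Prod.snd S = 1
      refine (prob_compl_eq_zero_iff hSm).mp ?_
      rw [Measure.map_apply measurable_snd hSm.compl]
      have hsub : Prod.snd ⁻¹' Sᶜ ⊆ (S ×ˢ S)ᶜ :=
        fun (p : Euc n × Euc n) (hp : p.2 ∉ S) hp' => hp hp'.2
      exact measure_mono_null hsub h2
    refine ⟨⟨π.map Prod.snd, hPp⟩, hPS, ?_, ?_⟩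
    · refine (iInf_le_of_le π (iInf_le_of_le h1 (iInf_le_of_le rfl le_rfl))).trans ?_
      rw [hlint π hπ h2]
      exact ENNReal.ofReal_le_ofReal h3
    · rw [hcost _ hPS]
      exact (integral_map measurable_snd.aemeasurable hl'm.aestronglyMeasurable).symm
  have hVne : V.Nonempty := by
    have hm : Measurable (fun ξ : Euc n => (ξ, ξ)) := measurable_id.prodMk measurable_id
    obtain ⟨P, h1, h2, _⟩ := hprimal ((Phat : Measure (Euc n)).map (fun ξ => (ξ, ξ)))
      (by rw [Measure.map_map measurable_fst hm]; exact Measure.map_id)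
      (by
        rw [Measure.map_apply hm hSSm.compl]
        exact measure_mono_null (fun p hp hp' => hp ⟨hp', hp'⟩) hμS)
      (by
        rw [integral_map hm.aemeasurable hc'm.aestronglyMeasurable]
        simp only [hc'd, integral_zero]
        exact hε0.le)
    exact ⟨_, P, h1, h2, rfl⟩
  let ψ : ℝ → Euc n → ℝ := fun γ => auxPsi S c ℓ ε K x γ
  let ψ' : ℝ → Euc n → ℝ := fun γ => S.indicator (ψ γ)
  have hψm : ∀ γ, Measurable (ψ' γ) := fun γ =>
    aux_psi_meas hS hclsc hc0 (husc x) hB hε0 hεD K γ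
  have hψ0 : ∀ γ ξ, 0 ≤ ψ' γ ξ := fun γ ξ =>
    indicator_nonneg (fun ξ hξ => aux_psi_nonneg hc0 (h0 x) hB ε K γ hξ) ξ
  have hψB : ∀ γ, 0 ≤ γ → ∀ ξ, ψ' γ ξ ≤ B := fun γ hγ ξ =>
    indicator_le' (fun ξ hξ => aux_psi_le hc0 hε0 hεD K hγ hξ (fun ξ' hξ' => by
      have := hB ξ' hξ'
      have := mul_nonneg hγ (hcnn ξ hξ ξ' hξ')
      linarith)) (fun _ _ => hB0) ξ
  have hψint : ∀ γ, ∫ ξ, ψ γ ξ ∂(Phat : Measure (Euc n)) =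
      ∫ ξ, ψ' γ ξ ∂(Phat : Measure (Euc n)) := by
    intro γ
    refine integral_congr_ae ?_
    filter_upwards [hμae] with ξ hξ
    simp only [ψ', indicator_of_mem hξ]
  have hψint0 : ∀ γ, 0 ≤ ∫ ξ, ψ γ ξ ∂(Phat : Measure (Euc n)) := fun γ => by
    rw [hψint]
    exact integral_nonneg (hψ0 γ)
  set W : Set ℝ := {v | ∃ γ : ℝ, 0 ≤ γ ∧
    v = (∫ ξ, ψ γ ξ ∂(Phat : Measure (Euc n))) + ε * γ} with hW
  have hKeq : Dro.cTransK S c ℓ ε K x Phat = sInf W := rfl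
  have hTeq : Dro.cTrans S c ℓ ε x Phat = sSup V := rfl
  rw [hKeq, hTeq]
  constructor
  · obtain ⟨γ, hγ, hγT⟩ := aux_strong hSm (Phat : Measure (Euc n)) hμS hc'm hc'0 hc'D hc'd
      hl'm hl'0 hl'B hε0 (v := sSup V) (by
        intro π h1 h2 h3
        obtain ⟨P, hP1, hP2, hP3⟩ := hprimal π h1 h2 h3
        rw [hP3]
        exact le_csSup hVbdd ⟨P, hP1, hP2, rfl⟩)
    have hh : UpperSemicontinuousOn (fun p : Euc n × Euc n => ℓ x p.2 + (-γ) * c p.1 p.2)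
        (S ×ˢ S) := by
      refine UpperSemicontinuousOn.add ?_ ?_
      · exact UpperSemicontinuousOn.comp (f := ℓ x) (g := fun p : Euc n × Euc n => p.2) (husc x)
          (by fun_prop) (fun p hp => hp.2)
      · exact (continuous_const.mul continuous_id :
          Continuous (fun t : ℝ => (-γ) * t)).comp_lowerSemicontinuousOn_antitone hclsc
          (fun a b hab => by
            have := mul_le_mul_of_nonneg_left hab hγ
            show (-γ) * b ≤ (-γ) * a
            linarith)
    obtain ⟨T, hTm, hTS, hTmax⟩ := aux_selection hS hne hh
    refine le_trans ?_ (hγT T hTm hTS)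
    have hWbdd : BddBelow W := by
      refine ⟨0, ?_⟩
      rintro v ⟨γ', hγ', rfl⟩
      have := hψint0 γ'
      have := mul_nonneg hε0.le hγ'
      linarith
    have hWle : sInf W ≤ (∫ ξ, ψ γ ξ ∂(Phat : Measure (Euc n))) + ε * γ :=
      csInf_le hWbdd ⟨γ, hγ, rfl⟩
    refine hWle.trans ?_
    · gcongr ?_ + _
      rw [hψint]
      have hm : Measurable (fun ξ => (ξ, T ξ)) := measurable_id.prodMk hTm
      have i1 : Integrable (fun ξ => l' (T ξ)) (Phat : Measure (Euc n)) :=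
        aux_integrable (hl'm.comp hTm) (fun _ => hl'0 _) (fun _ => hl'B _)
      have i2 : Integrable (fun ξ => c' (ξ, T ξ)) (Phat : Measure (Euc n)) :=
        aux_integrable (hc'm.comp hm) (fun _ => hc'0 _) (fun _ => hc'D _)
      refine integral_mono_ae (aux_integrable (hψm γ) (hψ0 γ) (hψB γ hγ))
        (i1.sub (i2.const_mul γ)) ?_
      filter_upwards [hμae] with ξ hξ
      have e1 : ψ' γ ξ = ψ γ ξ := indicator_of_mem hξ _
      have e2 : l' (T ξ) = ℓ x (T ξ) := indicator_of_mem (hTS ξ) _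
      have e3 : c' (ξ, T ξ) = c ξ (T ξ) :=
        indicator_of_mem (show (ξ, T ξ) ∈ S ×ˢ S from ⟨hξ, hTS ξ⟩) _
      rw [e1, e2, e3]
      refine aux_psi_le hc0 hε0 hεD K hγ hξ fun ξ' hξ' => ?_
      have := hTmax ξ hξ ξ' hξ'
      simp only at this
      linarith
  · set ρ : ℝ := (Metric.diam S / ε) ^ ((1 : ℝ) / (K : ℝ)) with hρ
    have hK0 : (0 : ℝ) < K := by exact_mod_cast hK
    have hρ1 : 1 ≤ ρ := Real.one_le_rpow ((one_le_div hε0).mpr hεD) (by positivity)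
    have hKi : 0 < 1 / (K : ℝ) := by positivity
    have hf : 0 < ρ + 1 / (K : ℝ) := by linarith
    have hWne : W.Nonempty := ⟨_, 0, le_rfl, rfl⟩
    rw [mul_comm, ← div_le_iff₀ hf]
    refine le_csInf hWne ?_
    rintro w ⟨γ, hγ, rfl⟩
    rw [div_le_iff₀ hf]
    refine csSup_le hVne ?_
    rintro v ⟨P, hP, hPW, rfl⟩
    have hmain : Dro.cost ℓ x P ≤
        ∫ ξ, ψ γ ξ ∂(Phat : Measure (Euc n)) + γ * ρ * ε + γ * (ε / K) := by
      have hη : ∀ η : ℝ, 0 < η → Dro.cost ℓ x P ≤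
          (∫ ξ, ψ γ ξ ∂(Phat : Measure (Euc n)) + γ * ρ * ε + γ * (ε / K)) + γ * ρ * η := by
        intro η hη
        have hlt : Dro.wCost c (Phat : Measure (Euc n)) (P : Measure (Euc n)) <
            ENNReal.ofReal (ε + η) :=
          hPW.trans_lt ((ENNReal.ofReal_lt_ofReal_iff (by linarith)).mpr (by linarith))
        unfold Dro.wCost at hlt
        simp only [iInf_lt_iff] at hlt
        obtain ⟨π, h1, h2, h3⟩ := hlt
        have hπ := aux_prob_of_map measurable_fst h1
        have hPae : (P : Measure (Euc n)) Sᶜ = 0 := (prob_compl_eq_zero_iff hSm).mpr hP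
        have a1 : ∀ᵐ p ∂π, p.1 ∈ S := by
          rw [← h1, Measure.map_apply measurable_fst hSm.compl] at hμS
          exact hμS
        have a2 : ∀ᵐ p ∂π, p.2 ∈ S := by
          rw [← h2, Measure.map_apply measurable_snd hSm.compl] at hPae
          exact hPae
        have a3 : ∀ᵐ p ∂π, p ∈ S ×ˢ S := by
          filter_upwards [a1, a2] with p h h' using ⟨h, h'⟩
        rw [hlint π hπ a3] at h3
        have h4 : ∫ p, c' p ∂π < ε + η := (ENNReal.ofReal_lt_ofReal_iff (by linarith)).mp h3
        have j1 : Integrable (fun p : Euc n × Euc n => ψ' γ p.1) π :=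
          aux_integrable ((hψm γ).comp measurable_fst) (fun _ => hψ0 γ _) (fun _ => hψB γ hγ _)
        have j2 : Integrable (fun p => γ * ρ * c' p) π :=
          (aux_integrable hc'm hc'0 hc'D).const_mul _
        have j3 : Integrable (fun p : Euc n × Euc n => l' p.2) π :=
          aux_integrable (hl'm.comp measurable_snd) (fun _ => hl'0 _) (fun _ => hl'B _)
        have j12 : Integrable (fun p : Euc n × Euc n => ψ' γ p.1 + γ * ρ * c' p) π := j1.add j2
        have e1 : Dro.cost ℓ x P = ∫ p, l' p.2 ∂π := by
          rw [hcost P hP, ← h2]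
          exact integral_map measurable_snd.aemeasurable hl'm.aestronglyMeasurable
        have e2 : ∫ ξ, ψ γ ξ ∂(Phat : Measure (Euc n)) = ∫ p, ψ' γ p.1 ∂π := by
          rw [hψint, ← h1]
          exact integral_map measurable_fst.aemeasurable (hψm γ).aestronglyMeasurable
        have e3 : ∫ p, l' p.2 ∂π ≤ ∫ p, (ψ' γ p.1 + γ * ρ * c' p + γ * (ε / K)) ∂π := by
          refine integral_mono_ae j3 (j12.add (integrable_const _)) ?_
          filter_upwards [a3] with p hp
          have f1 : ψ' γ p.1 = ψ γ p.1 := indicator_of_mem hp.1 _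
          have f2 : l' p.2 = ℓ x p.2 := indicator_of_mem hp.2 _
          have f3 : c' p = c p.1 p.2 := indicator_of_mem hp _
          simp only [f1, f2, f3]
          exact aux_disc hcnn hcub hB hε0 hεD hK hγ hp.1 hp.2
        rw [integral_add j12 (integrable_const _), integral_add j1 j2, integral_const_mul] at e3
        simp only [integral_const, probReal_univ, one_smul] at e3
        rw [e1, e2]
        have h5 := mul_le_mul_of_nonneg_left h4.le (mul_nonneg hγ (by linarith : 0 ≤ ρ))
        linarith
      rcases (mul_nonneg hγ (by linarith : 0 ≤ ρ)).eq_or_lt with h | h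
      · have := hη 1 one_pos
        rw [← h] at this ⊢
        linarith
      · refine le_of_forall_pos_le_add fun η hη' => ?_
        have := hη (η / (γ * ρ)) (by positivity)
        rwa [mul_div_cancel₀ _ h.ne'] at this
    refine hmain.trans ?_
    have h1 := hψint0 γ
    have h2 : 0 ≤ (∫ ξ, ψ γ ξ ∂(Phat : Measure (Euc n))) * (ρ + 1 / (K : ℝ) - 1) :=
      mul_nonneg h1 (by linarith)
    have h3 : γ * (ε / K) = ε * γ * (1 / (K : ℝ)) := by ring
    rw [h3]
    nlinarith
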